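/- Let P be an n×n nonnegative matrix. There exists a positive vector x (all entries > 0) with ρ(P)·x - Px ≥ 0 entrywise if and only if every basic class of P is final. -/

import Mathlib

open Filter Matrix
open scoped Topology Classical

attribute [local instance] Matrix.linftyOpNormedAddCommGroup

/-- The spectral radius of a real matrix, via Gelfand's formula. -/
noncomputable def rho {n : ℕ} (A : Matrix (Fin n) (Fin n) ℝ) : ℝ :=
  limsup (fun m : ℕ => ‖A ^ m‖ ^ ((1 : ℝ) / m)) atTop

/-- `i` has access to `j` in the directed graph of `P` (edges where `P a b > 0`). -/
def Access {n : ℕ} (P : Matrix (Fin n) (Fin n) ℝ) (i j : Fin n) : Prop :=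
  Relation.ReflTransGen (fun a b => 0 < P a b) i j

/-- The matrix obtained from `P` by zeroing all entries outside `α × α`, where `α` is the
class (strongly connected component) of the vertex `i`; its spectral radius is `ρ(P_{αα})`. -/
noncomputable def classMatrix {n : ℕ} (P : Matrix (Fin n) (Fin n) ℝ) (i : Fin n) :
    Matrix (Fin n) (Fin n) ℝ :=
  fun a b =>
    if (Access P i a ∧ Access P a i) ∧ (Access P i b ∧ Access P b i) then P a b else 0

attribute [local instance] Matrix.linftyOpNormedRing

lemma u_nonneg {n : ℕ} (A : Matrix (Fin n) (Fin n) ℝ) (m : ℕ) :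
    0 ≤ ‖A ^ m‖ ^ ((1 : ℝ) / m) := Real.rpow_nonneg (norm_nonneg _) _

lemma u_le {n : ℕ} (A : Matrix (Fin n) (Fin n) ℝ) (m : ℕ) (hm : 0 < m) :
    ‖A ^ m‖ ^ ((1 : ℝ) / m) ≤ ‖A‖ := by
  have h : ‖A ^ m‖ ≤ ‖A‖ ^ m := norm_pow_le' A hm
  calc ‖A ^ m‖ ^ ((1 : ℝ) / m) ≤ (‖A‖ ^ m) ^ ((1 : ℝ) / m) :=
        Real.rpow_le_rpow (norm_nonneg _) h (by positivity)
    _ = ‖A‖ := by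
        rw [one_div]; exact Real.pow_rpow_inv_natCast (norm_nonneg _) hm.ne'

lemma u_bdd {n : ℕ} (A : Matrix (Fin n) (Fin n) ℝ) :
    IsBoundedUnder (· ≤ ·) atTop (fun m : ℕ => ‖A ^ m‖ ^ ((1 : ℝ) / m)) :=
  ⟨‖A‖, by
    rw [eventually_map]
    filter_upwards [eventually_gt_atTop 0] with m hm using u_le A m hm⟩

lemma u_cobdd {n : ℕ} (A : Matrix (Fin n) (Fin n) ℝ) :
    IsCoboundedUnder (· ≤ ·) atTop (fun m : ℕ => ‖A ^ m‖ ^ ((1 : ℝ) / m)) :=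
  IsBoundedUnder.isCoboundedUnder_le
    ⟨0, by rw [eventually_map]; exact Eventually.of_forall (fun m => u_nonneg A m)⟩

lemma rho_nonneg {n : ℕ} (A : Matrix (Fin n) (Fin n) ℝ) : 0 ≤ rho A :=
  le_limsup_of_frequently_le (Frequently.of_forall (fun m => u_nonneg A m)) (u_bdd A)

lemma mv {n : ℕ} (A : Matrix (Fin n) (Fin n) ℝ) (x : Fin n → ℝ) (i : Fin n) :
    (A *ᵥ x) i = ∑ j, A i j * x j := rfl

lemma mulVec_nn {n : ℕ} {A : Matrix (Fin n) (Fin n) ℝ} (hA : ∀ i j, 0 ≤ A i j)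
    {x : Fin n → ℝ} (hx : ∀ i, 0 ≤ x i) (i : Fin n) : 0 ≤ (A *ᵥ x) i := by
  rw [mv]
  exact Finset.sum_nonneg (fun j _ => mul_nonneg (hA i j) (hx j))

lemma mulVec_mono' {n : ℕ} {A : Matrix (Fin n) (Fin n) ℝ} (hA : ∀ i j, 0 ≤ A i j)
    {x y : Fin n → ℝ} (hx : ∀ i, x i ≤ y i) (i : Fin n) : (A *ᵥ x) i ≤ (A *ᵥ y) i := by
  rw [mv, mv]
  exact Finset.sum_le_sum (fun j _ => mul_le_mul_of_nonneg_left (hx j) (hA i j))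

lemma pow_nn {n : ℕ} {A : Matrix (Fin n) (Fin n) ℝ} (hA : ∀ i j, 0 ≤ A i j) (m : ℕ) :
    ∀ i j, 0 ≤ (A ^ m) i j := by
  induction m with
  | zero => intro i j; rw [pow_zero, Matrix.one_apply]; split_ifs <;> norm_num
  | succ m ih =>
    intro i j
    rw [pow_succ, Matrix.mul_apply]
    exact Finset.sum_nonneg (fun k _ => mul_nonneg (ih i k) (hA k j))

lemma row_le_norm {n : ℕ} (A : Matrix (Fin n) (Fin n) ℝ) (i : Fin n) :
    ∑ j, A i j ≤ ‖A‖ := by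
  have h1 : ∑ j, A i j ≤ ∑ j, ‖A i j‖ := Finset.sum_le_sum (fun j _ => Real.le_norm_self _)
  refine h1.trans ?_
  rw [Matrix.linfty_opNorm_def]
  have := Finset.le_sup (f := fun i => ∑ j, ‖A i j‖₊) (Finset.mem_univ i)
  have h2 : ((∑ j, ‖A i j‖₊ : NNReal) : ℝ) ≤ _ := NNReal.coe_le_coe.mpr this
  simpa using h2

lemma norm_le_row {n : ℕ} (A : Matrix (Fin n) (Fin n) ℝ) (hA : ∀ i j, 0 ≤ A i j)
    (C : ℝ) (hC : 0 ≤ C) (h : ∀ i, ∑ j, A i j ≤ C) : ‖A‖ ≤ C := by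
  rw [Matrix.linfty_opNorm_def]
  have : (Finset.univ.sup fun i => ∑ j, ‖A i j‖₊) ≤ (⟨C, hC⟩ : NNReal) := by
    refine Finset.sup_le (fun i _ => ?_)
    refine NNReal.coe_le_coe.mp ?_
    refine le_trans (le_of_eq ?_) (h i)
    push_cast
    exact Finset.sum_congr rfl (fun j _ => by rw [Real.norm_of_nonneg (hA i j)])
  exact NNReal.coe_le_coe.mpr this

/-- A positive subinvariant vector bounds the spectral radius. -/
lemma rho_le {n : ℕ} {A : Matrix (Fin n) (Fin n) ℝ} (hA : ∀ i j, 0 ≤ A i j)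
    {x : Fin n → ℝ} (hx : ∀ i, 0 < x i) {r : ℝ} (hr : 0 ≤ r)
    (h : ∀ i, (A *ᵥ x) i ≤ r * x i) : rho A ≤ r := by
  have hpow : ∀ m : ℕ, ∀ i, ((A ^ m) *ᵥ x) i ≤ r ^ m * x i := by
    intro m
    induction m with
    | zero => intro i; simp
    | succ m ih =>
      intro i
      rw [pow_succ', ← Matrix.mulVec_mulVec]
      calc (A *ᵥ (A ^ m *ᵥ x)) i ≤ (A *ᵥ (r ^ m • x)) i := mulVec_mono' hA (by simpa using ih) i
        _ = r ^ m * (A *ᵥ x) i := by rw [Matrix.mulVec_smul]; rfl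
        _ ≤ r ^ m * (r * x i) := mul_le_mul_of_nonneg_left (h i) (pow_nonneg hr m)
        _ = _ := by ring
  obtain ⟨C, hC, hCb⟩ : ∃ C : ℝ, 0 < C ∧ ∀ i j, x i ≤ C * x j := by
    refine ⟨1 + ∑ i, ∑ j, x i / x j, ?_, ?_⟩
    · have : 0 ≤ ∑ i, ∑ j, x i / x j := Finset.sum_nonneg fun i _ => Finset.sum_nonneg fun j _ =>
        (div_pos (hx i) (hx j)).le
      linarith
    · intro i j
      rw [← div_le_iff₀ (hx j)]
      have h1 : x i / x j ≤ ∑ j, x i / x j :=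
        Finset.single_le_sum (f := fun j => x i / x j)
          (fun j _ => (div_pos (hx i) (hx j)).le) (Finset.mem_univ j)
      have h2 : ∑ j, x i / x j ≤ ∑ i, ∑ j, x i / x j :=
        Finset.single_le_sum (f := fun i => ∑ j, x i / x j)
          (fun i _ => Finset.sum_nonneg fun j _ => (div_pos (hx i) (hx j)).le) (Finset.mem_univ i)
      linarith
  have hnorm : ∀ m : ℕ, ‖A ^ m‖ ≤ C * r ^ m := by
    intro m
    refine norm_le_row _ (pow_nn hA m) _ (by positivity) (fun i => ?_)
    have h1 : (∑ j, (A ^ m) i j) * x i ≤ C * ((A ^ m) *ᵥ x) i := by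
      simp only [Matrix.mulVec, dotProduct]
      rw [Finset.sum_mul, Finset.mul_sum]
      refine Finset.sum_le_sum (fun j _ => ?_)
      have := mul_le_mul_of_nonneg_left (hCb i j) (pow_nn hA m i j)
      linarith
    have h2 := mul_le_mul_of_nonneg_left (hpow m i) hC.le
    refine le_of_mul_le_mul_right (a := x i) ?_ (hx i)
    linarith
  have hlim : Tendsto (fun m : ℕ => C ^ ((1 : ℝ) / m) * r) atTop (𝓝 r) := by
    have h0 : Tendsto (fun m : ℕ => (1 : ℝ) / m) atTop (𝓝 0) := tendsto_one_div_atTop_nhds_zero_nat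
    have h1 : Tendsto (fun m : ℕ => C ^ ((1 : ℝ) / m)) atTop (𝓝 (C ^ (0 : ℝ))) :=
      (Real.continuousAt_const_rpow hC.ne').tendsto.comp h0
    simpa using h1.mul_const r
  calc rho A ≤ limsup (fun m : ℕ => C ^ ((1 : ℝ) / m) * r) atTop := by
        refine limsup_le_limsup ?_ (u_cobdd A) hlim.isBoundedUnder_le
        filter_upwards [eventually_gt_atTop 0] with m hm
        calc ‖A ^ m‖ ^ ((1 : ℝ) / m) ≤ (C * r ^ m) ^ ((1 : ℝ) / m) :=
              Real.rpow_le_rpow (norm_nonneg _) (hnorm m) (by positivity)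
          _ = C ^ ((1 : ℝ) / m) * r := by
              rw [Real.mul_rpow hC.le (by positivity)]
              congr 1
              rw [one_div]; exact Real.pow_rpow_inv_natCast hr hm.ne'
    _ = r := hlim.limsup_eq

/-- Above the spectral radius there are positive subinvariant vectors. -/
lemma exists_sub {n : ℕ} {A : Matrix (Fin n) (Fin n) ℝ} (hA : ∀ i j, 0 ≤ A i j)
    {r : ℝ} (hr : rho A < r) :
    ∃ x : Fin n → ℝ, (∀ i, 0 < x i) ∧ ∀ i, (A *ᵥ x) i ≤ r * x i := by
  have hr0 : 0 < r := lt_of_le_of_lt (rho_nonneg A) hr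
  have hev : ∀ᶠ m : ℕ in atTop, ‖A ^ m‖ ^ ((1 : ℝ) / m) < r := eventually_lt_of_limsup_lt hr (u_bdd A)
  obtain ⟨m, hm, hm0⟩ := (hev.and (eventually_gt_atTop 0)).exists
  have hn : ‖A ^ m‖ ≤ r ^ m := by
    have := pow_le_pow_left₀ (u_nonneg A m) hm.le m
    rwa [one_div, Real.rpow_inv_natCast_pow (norm_nonneg _) hm0.ne'] at this
  have key : ∀ m : ℕ, ∃ x : Fin n → ℝ, (∀ i, 0 < x i) ∧
      r • x - A *ᵥ x = r ^ (m + 1) • (1 : Fin n → ℝ) - (A ^ (m + 1)) *ᵥ 1 := by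
    intro m
    induction m with
    | zero => exact ⟨1, fun i => one_pos, by simp⟩
    | succ m ih =>
      obtain ⟨x, hx, he⟩ := ih
      refine ⟨r • x + (A ^ (m + 1)) *ᵥ 1, fun i => ?_, ?_⟩
      · have := mulVec_nn (pow_nn hA (m + 1)) (x := 1) (fun i => zero_le_one) i
        have h2 := mul_pos hr0 (hx i)
        simp only [Pi.add_apply, Pi.smul_apply, smul_eq_mul]
        linarith
      · rw [Matrix.mulVec_add, Matrix.mulVec_smul, Matrix.mulVec_mulVec, ← pow_succ',
          show r • (r • x + (A ^ (m + 1)) *ᵥ 1) - (r • A *ᵥ x + A ^ (m + 1 + 1) *ᵥ 1)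
            = r • (r • x - A *ᵥ x) + r • ((A ^ (m + 1)) *ᵥ 1) - A ^ (m + 1 + 1) *ᵥ 1 by
              rw [smul_add, smul_sub]; abel, he, smul_sub, smul_smul, ← pow_succ']
        abel
  obtain ⟨x, hx, he⟩ := key (m - 1)
  rw [Nat.sub_add_cancel hm0] at he
  refine ⟨x, hx, fun i => ?_⟩
  have h1 := congrFun he i
  have h0 : (A ^ m *ᵥ (1 : Fin n → ℝ)) i = ∑ j, (A ^ m) i j := by rw [mv]; simp
  have h2 := (row_le_norm (A ^ m) i).trans hn
  simp only [Pi.sub_apply, Pi.smul_apply, smul_eq_mul, Pi.one_apply, mul_one, h0] at h1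
  linarith

lemma rho_mono {n : ℕ} {A B : Matrix (Fin n) (Fin n) ℝ} (hA : ∀ i j, 0 ≤ A i j)
    (hAB : ∀ i j, A i j ≤ B i j) : rho A ≤ rho B := by
  refine le_of_forall_gt_imp_ge_of_dense (fun r hr => ?_)
  obtain ⟨x, hx, h⟩ := exists_sub (fun i j => (hA i j).trans (hAB i j)) hr
  refine rho_le hA hx ((rho_nonneg B).trans hr.le) (fun i => le_trans ?_ (h i))
  rw [mv, mv]
  exact Finset.sum_le_sum (fun j _ => mul_le_mul_of_nonneg_right (hAB i j) (hx j).le)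

/-- Strictness propagates backwards. -/
lemma rho_lt {n : ℕ} {A : Matrix (Fin n) (Fin n) ℝ} (hA : ∀ i j, 0 ≤ A i j)
    {r : ℝ} (hr : 0 < r) {x : Fin n → ℝ} (hx : ∀ i, 0 < x i)
    (h : ∀ i, (A *ᵥ x) i ≤ r * x i)
    (hacc : ∀ c, ∃ a, Relation.ReflTransGen (fun a b => 0 < A a b) c a ∧ (A *ᵥ x) a < r * x a) :
    rho A < r := by
  -- iterate x ↦ x + A x
  have step : ∀ N : ℕ, ∃ y : Fin n → ℝ, (∀ i, 0 < y i) ∧ (∀ i, (A *ᵥ y) i ≤ r * y i) ∧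
      (fun i => r * y i - (A *ᵥ y) i) = ((1 + A) ^ N) *ᵥ (fun i => r * x i - (A *ᵥ x) i) := by
    intro N
    induction N with
    | zero => exact ⟨x, hx, h, by simp⟩
    | succ N ih =>
      obtain ⟨y, hy, h1, h2⟩ := ih
      refine ⟨y + A *ᵥ y, fun i => ?_, ?_, ?_⟩
      · exact add_pos_of_pos_of_nonneg (hy i) (mulVec_nn hA (fun j => (hy j).le) i)
      · intro i
        have h3 := mulVec_mono' hA h1 i
        have h4 : (A *ᵥ fun i => r * y i) i = r * (A *ᵥ y) i :=
          congrFun (Matrix.mulVec_smul A r y) i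
        rw [Matrix.mulVec_add]
        simp only [Pi.add_apply]
        have := h1 i
        linarith
      · rw [pow_succ', ← Matrix.mulVec_mulVec, ← h2, Matrix.add_mulVec, Matrix.one_mulVec]
        have h5 : (fun i => r * y i - (A *ᵥ y) i) = r • y - A *ᵥ y := rfl
        rw [h5, Matrix.mulVec_sub, Matrix.mulVec_smul, Matrix.mulVec_add]
        ext i
        simp only [Pi.add_apply, Pi.sub_apply, Pi.smul_apply, smul_eq_mul]
        ring
  set z : Fin n → ℝ := fun i => r * x i - (A *ᵥ x) i with hz
  have hz0 : ∀ i, 0 ≤ z i := fun i => sub_nonneg.mpr (h i)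
  have h1A : ∀ i j, 0 ≤ (1 + A) i j := fun i j => by
    have : 0 ≤ (1 : Matrix (Fin n) (Fin n) ℝ) i j := by
      rw [Matrix.one_apply]; split_ifs <;> norm_num
    exact add_nonneg this (hA i j)
  have hnn : ∀ N i, 0 ≤ (((1 + A) ^ N) *ᵥ z) i := fun N i => mulVec_nn (pow_nn h1A N) hz0 i
  have hsucc : ∀ N i, (((1 + A) ^ (N + 1)) *ᵥ z) i
      = (((1 + A) ^ N) *ᵥ z) i + (A *ᵥ (((1 + A) ^ N) *ᵥ z)) i := fun N i => by
    rw [pow_succ', ← Matrix.mulVec_mulVec, Matrix.add_mulVec, Matrix.one_mulVec]; rfl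
  have hmono : ∀ i, Monotone (fun N => (((1 + A) ^ N) *ᵥ z) i) := fun i =>
    monotone_nat_of_le_succ (fun N => by
      rw [hsucc]
      have := mulVec_nn hA (hnn N) i
      linarith)
  have hpos : ∀ c, ∃ N, 0 < (((1 + A) ^ N) *ᵥ z) c := by
    intro c
    obtain ⟨a, hca, ha⟩ := hacc c
    induction hca using Relation.ReflTransGen.head_induction_on with
    | refl => exact ⟨0, by simpa [hz] using ha⟩
    | head hab _ ih =>
      rename_i p q _
      obtain ⟨N, hN⟩ := ih
      refine ⟨N + 1, ?_⟩
      rw [hsucc]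
      refine add_pos_of_nonneg_of_pos (hnn N p) ?_
      exact Finset.sum_pos' (fun j _ => mul_nonneg (hA p j) (hnn N j))
        ⟨q, Finset.mem_univ q, mul_pos hab hN⟩
  choose K hK using hpos
  obtain ⟨y, hy, _, h2⟩ := step (Finset.univ.sup K)
  have hstrict : ∀ i, (A *ᵥ y) i < r * y i := by
    intro i
    have h3 := congrFun h2 i
    have h4 := hmono i (Finset.le_sup (f := K) (Finset.mem_univ i))
    have h5 := hK i
    simp only at h3 h4
    linarith
  -- uniform gap
  obtain ⟨s, hs0, hs, hsr⟩ : ∃ s : ℝ, 0 ≤ s ∧ (∀ i, (A *ᵥ y) i ≤ s * y i) ∧ s < r := by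
    rcases isEmpty_or_nonempty (Fin n) with he | he
    · exact ⟨0, le_rfl, fun i => he.elim i, hr⟩
    · obtain ⟨i₀, hi₀⟩ := Finite.exists_max (fun i => (A *ᵥ y) i / y i)
      refine ⟨(A *ᵥ y) i₀ / y i₀,
        div_nonneg (mulVec_nn hA (fun j => (hy j).le) i₀) (hy i₀).le, fun i => ?_, ?_⟩
      · rw [← div_le_iff₀ (hy i)]; exact hi₀ i
      · rw [div_lt_iff₀ (hy i₀)]; exact hstrict i₀
  exact (rho_le hA hy hs0 hs).trans_lt hsr

lemma classMatrix_nn {n : ℕ} {P : Matrix (Fin n) (Fin n) ℝ} (hP : ∀ i j, 0 ≤ P i j)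
    (i : Fin n) : ∀ a b, 0 ≤ classMatrix P i a b := by
  intro a b; unfold classMatrix; split_ifs
  · exact hP a b
  · exact le_rfl

lemma classMatrix_le {n : ℕ} {P : Matrix (Fin n) (Fin n) ℝ} (hP : ∀ i j, 0 ≤ P i j)
    (i : Fin n) : ∀ a b, classMatrix P i a b ≤ P a b := by
  intro a b; unfold classMatrix; split_ifs
  · exact le_rfl
  · exact hP a b

/-- Paths inside a class are paths of the class matrix. -/
lemma class_path {n : ℕ} {P : Matrix (Fin n) (Fin n) ℝ} {i a c : Fin n}
    (h : Access P c a) (hic : Access P i c) (hai : Access P a i) :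
    Relation.ReflTransGen (fun a b => 0 < classMatrix P i a b) c a := by
  unfold Access at h
  induction h using Relation.ReflTransGen.head_induction_on with
  | refl => exact Relation.ReflTransGen.refl
  | head hpq hqa ih =>
    rename_i p q
    have hiq : Access P i q := hic.tail hpq
    have hqi : Access P q i := Relation.ReflTransGen.trans hqa hai
    have hpi : Access P p i := Relation.ReflTransGen.head hpq hqi
    refine Relation.ReflTransGen.head ?_ (ih hiq)
    unfold classMatrix
    rw [if_pos ⟨⟨hic, hpi⟩, ⟨hiq, hqi⟩⟩]
    exact hpq

lemma forward {n : ℕ} (P : Matrix (Fin n) (Fin n) ℝ) (hP : ∀ i j, 0 ≤ P i j)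
    (x : Fin n → ℝ) (hx : ∀ i, 0 < x i) (h : ∀ i, (P *ᵥ x) i ≤ rho P * x i)
    (i : Fin n) (hi : rho (classMatrix P i) = rho P) (j : Fin n) (hij : Access P i j) :
    Access P j i := by
  by_contra hji
  -- find the exit edge
  obtain ⟨a, b, hia, hai, hab, hbi⟩ : ∃ a b, Access P i a ∧ Access P a i ∧ 0 < P a b ∧
      ¬ Access P b i := by
    by_contra hno
    push Not at hno
    have : ∀ k, Access P i k → Access P k i := by
      intro k hk
      unfold Access at hk
      induction hk with
      | refl => exact Relation.ReflTransGen.refl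
      | tail h1 h2 ih => exact hno _ _ h1 ih h2
    exact hji (this j hij)
  have hle : ∀ c, (classMatrix P i *ᵥ x) c ≤ (P *ᵥ x) c := fun c => by
    rw [mv, mv]
    exact Finset.sum_le_sum (fun d _ => mul_le_mul_of_nonneg_right (classMatrix_le hP i c d) (hx d).le)
  have hlt : (classMatrix P i *ᵥ x) a < rho P * x a := by
    refine lt_of_lt_of_le ?_ (h a)
    rw [mv, mv]
    refine Finset.sum_lt_sum (fun d _ =>
      mul_le_mul_of_nonneg_right (classMatrix_le hP i a d) (hx d).le) ⟨b, Finset.mem_univ b, ?_⟩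
    have : classMatrix P i a b = 0 := by
      unfold classMatrix; rw [if_neg]; tauto
    rw [this, zero_mul]
    exact mul_pos hab (hx b)
  have hnn := classMatrix_nn hP i
  have hr : 0 < rho P := by
    have h1 := mulVec_nn hnn (fun j => (hx j).le) a
    have h2 : 0 < rho P * x a := lt_of_le_of_lt h1 hlt
    exact pos_of_mul_pos_left h2 (hx a).le
  have := rho_lt hnn hr hx (fun c => (hle c).trans (h c)) (fun c => by
    by_cases hc : Access P i c ∧ Access P c i
    · exact ⟨a, class_path (Relation.ReflTransGen.trans hc.2 hia) hc.1 hai, hlt⟩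
    · refine ⟨c, Relation.ReflTransGen.refl, ?_⟩
      have : (classMatrix P i *ᵥ x) c = 0 := by
        rw [mv]
        refine Finset.sum_eq_zero (fun d _ => ?_)
        have : classMatrix P i c d = 0 := by
          unfold classMatrix; rw [if_neg]; tauto
        rw [this, zero_mul]
      rw [this]
      exact mul_pos hr (hx c))
  exact this.ne hi

/-- Weak Perron: an irreducible block has a positive subinvariant vector at its radius. -/
lemma perron_class {n : ℕ} (P : Matrix (Fin n) (Fin n) ℝ) (hP : ∀ i j, 0 ≤ P i j) (i : Fin n) :
    ∃ x : Fin n → ℝ, (∀ a, 0 < x a) ∧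
      ∀ a, (classMatrix P i *ᵥ x) a ≤ rho (classMatrix P i) * x a := by
  set A := classMatrix P i with hAdef
  have hA : ∀ a b, 0 ≤ A a b := classMatrix_nn hP i
  let S : Fin n → Prop := fun a => Access P i a ∧ Access P a i
  have hSi : S i := ⟨Relation.ReflTransGen.refl, Relation.ReflTransGen.refl⟩
  have hcol : ∀ a b, ¬ S b → A a b = 0 := fun a b hb => by
    rw [hAdef]; unfold classMatrix; rw [if_neg]; exact fun hh => hb hh.2
  have hrow : ∀ a b, ¬ S a → A a b = 0 := fun a b hb => by
    rw [hAdef]; unfold classMatrix; rw [if_neg]; exact fun hh => hb hh.1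
  have hk : ∀ k : ℕ, ∃ x : Fin n → ℝ, x ∈ stdSimplex ℝ (Fin n) ∧ (∀ a, ¬ S a → x a = 0) ∧
      ∀ a, (A *ᵥ x) a ≤ (rho A + 1 / ((k : ℝ) + 1)) * x a := by
    intro k
    have hpos : (0 : ℝ) < 1 / ((k : ℝ) + 1) := by positivity
    obtain ⟨x, hx, h⟩ := exists_sub hA (r := rho A + 1 / ((k : ℝ) + 1)) (by linarith)
    let y : Fin n → ℝ := fun a => if S a then x a else 0
    have hy0 : ∀ a, 0 ≤ y a := fun a => by
      simp only [y]; split_ifs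
      · exact (hx a).le
      · exact le_rfl
    have hs : 0 < ∑ a, y a := Finset.sum_pos' (fun a _ => hy0 a)
      ⟨i, Finset.mem_univ i, by simp only [y]; rw [if_pos hSi]; exact hx i⟩
    have hyA : ∀ a, (A *ᵥ y) a ≤ (rho A + 1 / ((k : ℝ) + 1)) * y a := by
      intro a
      by_cases ha : S a
      · have h1 : (A *ᵥ y) a = (A *ᵥ x) a := by
          rw [mv, mv]
          refine Finset.sum_congr rfl (fun b _ => ?_)
          by_cases hb : S b
          · simp only [y]; rw [if_pos hb]
          · rw [hcol a b hb]; simp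
        have h2 : y a = x a := if_pos ha
        rw [h1, h2]; exact h a
      · have h1 : (A *ᵥ y) a = 0 := by
          rw [mv]; exact Finset.sum_eq_zero (fun b _ => by rw [hrow a b ha, zero_mul])
        have h2 : y a = 0 := if_neg ha
        rw [h1, h2, mul_zero]
    refine ⟨(∑ a, y a)⁻¹ • y, ⟨fun a => ?_, ?_⟩, fun a ha => ?_, fun a => ?_⟩
    · exact mul_nonneg (inv_nonneg.mpr hs.le) (hy0 a)
    · simp only [Pi.smul_apply, smul_eq_mul]
      rw [← Finset.mul_sum]; exact inv_mul_cancel₀ hs.ne'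
    · have h2 : y a = 0 := if_neg ha
      simp [h2]
    · rw [Matrix.mulVec_smul]
      simp only [Pi.smul_apply, smul_eq_mul]
      have := mul_le_mul_of_nonneg_left (hyA a) (inv_nonneg.mpr hs.le)
      linarith
  choose u hu1 hu2 hu3 using hk
  obtain ⟨x, hx, φ, hφ, hlim⟩ := (isCompact_stdSimplex ℝ (Fin n)).tendsto_subseq hu1
  have hlimc : ∀ a, Tendsto (fun k => u (φ k) a) atTop (𝓝 (x a)) := fun a =>
    (tendsto_pi_nhds.mp hlim) a
  have hxS : ∀ a, ¬ S a → x a = 0 := fun a ha =>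
    tendsto_nhds_unique (hlimc a) (by simp [hu2 _ a ha])
  have hxA : ∀ a, (A *ᵥ x) a ≤ rho A * x a := by
    intro a
    have h1 : Tendsto (fun k => (A *ᵥ (u (φ k))) a) atTop (𝓝 ((A *ᵥ x) a)) := by
      simp only [mv]
      exact tendsto_finsetSum _ (fun b _ => (hlimc b).const_mul (A a b))
    have h0 : Tendsto (fun k : ℕ => 1 / ((φ k : ℝ) + 1)) atTop (𝓝 0) :=
      (tendsto_one_div_add_atTop_nhds_zero_nat (𝕜 := ℝ)).comp hφ.tendsto_atTop
    have h2 : Tendsto (fun k => (rho A + 1 / ((φ k : ℝ) + 1)) * u (φ k) a) atTop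
        (𝓝 ((rho A + 0) * x a)) := (h0.const_add (rho A)).mul (hlimc a)
    rw [add_zero] at h2
    exact le_of_tendsto_of_tendsto' h1 h2 (fun k => hu3 (φ k) a)
  have hx0 := hx.1
  have hzero : ∀ c a, Relation.ReflTransGen (fun a b => 0 < A a b) c a → x c = 0 → x a = 0 := by
    intro c a hca hc
    induction hca with
    | refl => exact hc
    | tail _ hpq ih =>
      rename_i p q _
      have h1 := hxA p
      rw [ih, mul_zero] at h1
      have h2 : A p q * x q ≤ (A *ᵥ x) p :=
        Finset.single_le_sum (f := fun q => A p q * x q)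
          (fun q _ => mul_nonneg (hA p q) (hx0 q)) (Finset.mem_univ q)
      have h3 : A p q * x q ≤ A p q * 0 := by linarith
      exact le_antisymm (le_of_mul_le_mul_left h3 hpq) (hx0 q)
  have hxpos : ∀ c, S c → 0 < x c := by
    intro c hc
    refine lt_of_le_of_ne (hx0 c) (fun hc0 => ?_)
    have hall : ∀ a, x a = 0 := by
      intro a
      by_cases ha : S a
      · exact hzero c a (class_path (Relation.ReflTransGen.trans hc.2 ha.1) hc.1 ha.2) hc0.symm
      · exact hxS a ha
    have := hx.2
    simp [hall] at this
  refine ⟨fun a => if S a then x a else 1, fun a => ?_, fun a => ?_⟩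
  · simp only; split_ifs with ha
    · exact hxpos a ha
    · exact one_pos
  · by_cases ha : S a
    · have h1 : (A *ᵥ fun a => if S a then x a else 1) a = (A *ᵥ x) a := by
        rw [mv, mv]
        refine Finset.sum_congr rfl (fun b _ => ?_)
        by_cases hb : S b
        · rw [if_pos hb]
        · rw [hcol a b hb]; simp
      simp only
      rw [h1, if_pos ha]; exact hxA a
    · have h1 : (A *ᵥ fun a => if S a then x a else 1) a = 0 := by
        rw [mv]; exact Finset.sum_eq_zero (fun b _ => by rw [hrow a b ha, zero_mul])
      simp only
      rw [h1, if_neg ha, mul_one]; exact rho_nonneg A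

lemma classMatrix_congr {n : ℕ} (P : Matrix (Fin n) (Fin n) ℝ) {i j : Fin n}
    (hij : Access P i j) (hji : Access P j i) : classMatrix P i = classMatrix P j := by
  have h : ∀ a, (Access P i a ∧ Access P a i) ↔ (Access P j a ∧ Access P a j) := fun a =>
    ⟨fun h => ⟨Relation.ReflTransGen.trans hji h.1, Relation.ReflTransGen.trans h.2 hij⟩,
     fun h => ⟨Relation.ReflTransGen.trans hij h.1, Relation.ReflTransGen.trans h.2 hji⟩⟩
  ext a b
  unfold classMatrix
  simp only [h]

lemma backward {n : ℕ} (P : Matrix (Fin n) (Fin n) ℝ) (hP : ∀ i j, 0 ≤ P i j)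
    (hfin : ∀ i : Fin n, rho (classMatrix P i) = rho P →
        ∀ j : Fin n, Access P i j → Access P j i) :
    ∃ x : Fin n → ℝ, (∀ i, 0 < x i) ∧ ∀ i, (P *ᵥ x) i ≤ rho P * x i := by
  have hF : ∀ A : Matrix (Fin n) (Fin n) ℝ, ∃ y : Fin n → ℝ, (∃ i, A = classMatrix P i) →
      (∀ a, 0 < y a) ∧ (∀ a, (A *ᵥ y) a ≤ rho P * y a) ∧
      (rho A ≠ rho P → ∀ a, (A *ᵥ y) a < rho P * y a) := by
    intro A
    by_cases hA : ∃ i, A = classMatrix P i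
    · obtain ⟨i, rfl⟩ := hA
      have hle : rho (classMatrix P i) ≤ rho P := rho_mono (classMatrix_nn hP i) (classMatrix_le hP i)
      obtain ⟨y, hy, h⟩ := perron_class P hP i
      refine ⟨y, fun _ => ⟨hy, fun a => (h a).trans (mul_le_mul_of_nonneg_right hle (hy a).le), ?_⟩⟩
      intro hne a
      exact (h a).trans_lt (mul_lt_mul_of_pos_right (lt_of_le_of_ne hle hne) (hy a))
    · exact ⟨0, fun h => absurd h hA⟩
  choose F hF using hF
  let y : Fin n → ℝ := fun i => F (classMatrix P i) i
  have hy : ∀ i, 0 < y i := fun i => (hF _ ⟨i, rfl⟩).1 i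
  let A : Fin n → ℝ := fun a => (classMatrix P a *ᵥ y) a
  have hAeq : ∀ a, A a = (classMatrix P a *ᵥ F (classMatrix P a)) a := by
    intro a
    simp only [A]
    rw [mv, mv]
    refine Finset.sum_congr rfl (fun b _ => ?_)
    by_cases hb : Access P a b ∧ Access P b a
    · simp only [y]; rw [← classMatrix_congr P hb.1 hb.2]
    · have : classMatrix P a a b = 0 := by unfold classMatrix; rw [if_neg]; tauto
      rw [this, zero_mul, zero_mul]
  have hA1 : ∀ a, A a ≤ rho P * y a := fun a => by rw [hAeq]; exact (hF _ ⟨a, rfl⟩).2.1 a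
  have hA2 : ∀ a, rho (classMatrix P a) ≠ rho P → A a < rho P * y a := fun a h => by
    rw [hAeq]; exact (hF _ ⟨a, rfl⟩).2.2 h a
  let ht : Fin n → ℕ := fun a => (Finset.univ.filter (fun b => Access P a b)).card
  have ht_eq : ∀ a b, Access P a b → Access P b a → ht b = ht a := by
    intro a b hab hba
    simp only [ht]; congr 1; ext c
    simp only [Finset.mem_filter, Finset.mem_univ, true_and]
    exact ⟨fun h => Relation.ReflTransGen.trans hab h, fun h => Relation.ReflTransGen.trans hba h⟩
  have ht_lt : ∀ a b, Access P a b → ¬ Access P b a → ht b < ht a := by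
    intro a b hab hba
    refine Finset.card_lt_card ⟨fun c hc => ?_, fun hsub => hba ?_⟩
    · simp only [Finset.mem_filter, Finset.mem_univ, true_and] at hc ⊢
      exact Relation.ReflTransGen.trans hab hc
    · have : a ∈ Finset.univ.filter (fun c => Access P b c) := hsub (by
        simp only [Finset.mem_filter, Finset.mem_univ, true_and]; exact Relation.ReflTransGen.refl)
      simpa using this
  have hPy : ∀ a, 0 ≤ (P *ᵥ y) a := mulVec_nn hP (fun b => (hy b).le)
  obtain ⟨M, hM1, hM⟩ : ∃ M : ℝ, 1 ≤ M ∧ ∀ a, rho (classMatrix P a) ≠ rho P →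
      (P *ᵥ y) a ≤ M * (rho P * y a - A a) := by
    have hq : ∀ a, 0 ≤ (P *ᵥ y) a / (rho P * y a - A a) := fun a =>
      div_nonneg (hPy a) (sub_nonneg.mpr (hA1 a))
    refine ⟨1 + ∑ a, (P *ᵥ y) a / (rho P * y a - A a), ?_, fun a ha => ?_⟩
    · have := Finset.sum_nonneg (fun a (_ : a ∈ Finset.univ) => hq a)
      linarith
    · rw [← div_le_iff₀ (sub_pos.mpr (hA2 a ha))]
      have := Finset.single_le_sum (fun a _ => hq a) (Finset.mem_univ a)
      linarith
  have hM0 : 0 < M := by linarith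
  refine ⟨fun a => M ^ (ht a) * y a, fun a => mul_pos (pow_pos hM0 _) (hy a), fun a => ?_⟩
  have hsum0 : (P *ᵥ fun a => M ^ (ht a) * y a) a = ∑ b, P a b * (M ^ (ht b) * y b) := rfl
  simp only
  rw [hsum0]
  have hin : ∀ b, Access P a b ∧ Access P b a → classMatrix P a a b = P a b := fun b hb => by
    unfold classMatrix; rw [if_pos]
    exact ⟨⟨Relation.ReflTransGen.refl, Relation.ReflTransGen.refl⟩, hb⟩
  by_cases hbas : rho (classMatrix P a) = rho P
  · have h1 : ∑ b, P a b * (M ^ (ht b) * y b) = M ^ (ht a) * A a := by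
      simp only [A, Matrix.mulVec, dotProduct]
      rw [Finset.mul_sum]
      refine Finset.sum_congr rfl (fun b _ => ?_)
      rcases (hP a b).eq_or_lt with h0 | h0
      · have : classMatrix P a a b = 0 := by unfold classMatrix; split_ifs <;> simp [← h0]
        rw [this, ← h0]; ring
      · have hab : Access P a b := Relation.ReflTransGen.single h0
        have hba := hfin a hbas b hab
        rw [hin b ⟨hab, hba⟩, ht_eq a b hab hba]; ring
    rw [h1]
    have := mul_le_mul_of_nonneg_left (hA1 a) (pow_pos hM0 (ht a)).le
    linarith
  · have hpos : 0 < ht a := Finset.card_pos.mpr ⟨a, by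
      simp only [Finset.mem_filter, Finset.mem_univ, true_and]; exact Relation.ReflTransGen.refl⟩
    obtain ⟨k, hk⟩ : ∃ k, ht a = k + 1 := ⟨ht a - 1, by omega⟩
    have h1 : ∑ b, P a b * (M ^ (ht b) * y b) ≤ M ^ (ht a) * A a + M ^ k * (P *ᵥ y) a := by
      simp only [A, Matrix.mulVec, dotProduct]
      rw [Finset.mul_sum, Finset.mul_sum, ← Finset.sum_add_distrib]
      refine Finset.sum_le_sum (fun b _ => ?_)
      have hcn := classMatrix_nn hP a a b
      have hMk : 0 < M ^ k := pow_pos hM0 k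
      have hMa : 0 < M ^ ht a := pow_pos hM0 _
      have t1 : 0 ≤ M ^ k * (P a b * y b) := mul_nonneg hMk.le (mul_nonneg (hP a b) (hy b).le)
      have t2 : 0 ≤ M ^ ht a * (classMatrix P a a b * y b) :=
        mul_nonneg hMa.le (mul_nonneg hcn (hy b).le)
      rcases (hP a b).eq_or_lt with h0 | h0
      · rw [← h0] at t1 ⊢; linarith
      · have hab : Access P a b := Relation.ReflTransGen.single h0
        by_cases hba : Access P b a
        · rw [hin b ⟨hab, hba⟩, ht_eq a b hab hba]
          linarith
        · have h3 : M ^ ht b ≤ M ^ k :=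
            pow_le_pow_right₀ hM1 (by have := ht_lt a b hab hba; omega)
          have h4 := mul_le_mul_of_nonneg_right h3 (mul_nonneg (hP a b) (hy b).le)
          linarith
    have h2 := mul_le_mul_of_nonneg_left (hM a hbas) (pow_pos hM0 k).le
    refine h1.trans ?_
    rw [hk, pow_succ]
    nlinarith

/-- There exists a positive vector `x` with `ρ(P)·x - Px ≥ 0` iff every basic class of `P`
is final (accesses no class other than itself). -/
theorem stmt17 {n : ℕ} (P : Matrix (Fin n) (Fin n) ℝ) (hP : ∀ i j, 0 ≤ P i j) :
    (∃ x : Fin n → ℝ, (∀ i, 0 < x i) ∧ ∀ i, 0 ≤ (rho P • x - P.mulVec x) i) ↔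
      ∀ i : Fin n, rho (classMatrix P i) = rho P →
        ∀ j : Fin n, Access P i j → Access P j i := by
  constructor
  · rintro ⟨x, hx, h⟩ i hi j hij
    exact forward P hP x hx (fun a => sub_nonneg.mp (h a)) i hi j hij
  · intro h
    obtain ⟨x, hx, hle⟩ := backward P hP h
    exact ⟨x, hx, fun a => sub_nonneg.mpr (hle a)⟩
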